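/- Let 𝓞 be the ring of integers of a number field and let H be a finite-index subgroup of Γ = SL(2,𝓞) of level m. Then H is a congruence subgroup if and only if Γ(m𝓞) ⊆ H. -/

import Mathlib

open NumberField Matrix

variable (K : Type*) [Field K] [NumberField K]

/-- The elementary matrix `T_x = [[1, x], [0, 1]]` in `SL(2, 𝓞)`. -/
def T (x : 𝓞 K) : Matrix.SpecialLinearGroup (Fin 2) (𝓞 K) :=
  ⟨!![1, x; 0, 1], by simp [Matrix.det_fin_two_of]⟩

/-- The reduction homomorphism `SL(2, 𝓞) → SL(2, 𝓞/π)`. -/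
def red (π : Ideal (𝓞 K)) :
    Matrix.SpecialLinearGroup (Fin 2) (𝓞 K) →*
      Matrix.SpecialLinearGroup (Fin 2) ((𝓞 K) ⧸ π) :=
  Matrix.SpecialLinearGroup.map (Ideal.Quotient.mk π)

/-- The principal congruence subgroup `Γ(π)`, the kernel of reduction mod `π`. -/
def Gamma (π : Ideal (𝓞 K)) : Subgroup (Matrix.SpecialLinearGroup (Fin 2) (𝓞 K)) :=
  MonoidHom.ker (red K π)

/-- A subgroup of `Γ = SL(2,𝓞)` is a congruence subgroup if it contains `Γ(π)`
for some nonzero ideal `π` of `𝓞`. -/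
def IsCongruenceGamma (H : Subgroup (Matrix.SpecialLinearGroup (Fin 2) (𝓞 K))) : Prop :=
  ∃ π : Ideal (𝓞 K), π ≠ ⊥ ∧ Gamma K π ≤ H

/-- The normal closure in `Γ` of the set of the matrices `T_{mx}`, `x ∈ 𝓞`. -/
def Tclosure (m : ℕ) : Subgroup (Matrix.SpecialLinearGroup (Fin 2) (𝓞 K)) :=
  Subgroup.normalClosure
    {x : Matrix.SpecialLinearGroup (Fin 2) (𝓞 K) | ∃ a : 𝓞 K, x = T K ((m : 𝓞 K) * a)}

/-- `H` has level `m` : `m` is the smallest positive integer such that the normal closure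
in `Γ` of `{T_{mx} : x ∈ 𝓞}` is contained in `H`. -/
def HasLevel (H : Subgroup (Matrix.SpecialLinearGroup (Fin 2) (𝓞 K))) (m : ℕ) : Prop :=
  0 < m ∧ Tclosure K m ≤ H ∧ ∀ k : ℕ, 0 < k → Tclosure K k ≤ H → m ≤ k

theorem IsCoprime.exists_isUnit_add_mul {R : Type*} [CommRing R] [Finite R] {a b : R}
    (h : IsCoprime a b) : ∃ x : R, IsUnit (a + b * x) := by
  classical
  have hpair : Pairwise fun P Q : MaximalSpectrum R ↦ IsCoprime P.asIdeal Q.asIdeal :=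
    fun P Q hPQ ↦ Ideal.isCoprime_of_isMaximal fun hE ↦ hPQ (MaximalSpectrum.ext hE)
  obtain ⟨x, hx⟩ := Ideal.exists_forall_sub_mem_ideal hpair
    (fun P : MaximalSpectrum R ↦ if a ∈ P.asIdeal then (1 : R) else 0)
  refine ⟨x, ?_⟩
  by_contra hu
  obtain ⟨M, hM, hmem⟩ := exists_max_ideal_of_mem_nonunits hu
  have hxM := hx ⟨M, hM⟩
  by_cases ha : a ∈ M
  · simp only [ha, if_true] at hxM
    obtain ⟨u, v, huv⟩ := h
    refine hM.ne_top ((Ideal.eq_top_iff_one M).2 ?_)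
    have hone : (1 : R) = (u - v) * a + v * (a + b * x) - v * b * (x - 1) := by
      linear_combination -huv
    rw [hone]
    exact M.sub_mem (M.add_mem (M.mul_mem_left _ ha) (M.mul_mem_left _ hmem))
      (M.mul_mem_left _ hxM)
  · simp only [ha, if_false, sub_zero] at hxM
    exact ha ((Ideal.add_mem_iff_left M (M.mul_mem_left _ hxM)).1 hmem)

/-- The lower elementary matrix `[[1, 0], [x, 1]]` in `SL(2, 𝓞)`. -/
def lowerT (x : 𝓞 K) : Matrix.SpecialLinearGroup (Fin 2) (𝓞 K) :=
  ⟨!![1, 0; x, 1], by simp [Matrix.det_fin_two_of]⟩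

variable {K}

@[simp]
theorem coe_T (x : 𝓞 K) : (T K x : Matrix (Fin 2) (Fin 2) (𝓞 K)) = !![1, x; 0, 1] := rfl

@[simp]
theorem coe_lowerT (x : 𝓞 K) :
    (lowerT K x : Matrix (Fin 2) (Fin 2) (𝓞 K)) = !![1, 0; x, 1] := rfl

theorem T_mem_Tclosure (m : ℕ) (x : 𝓞 K) : T K (m * x) ∈ Tclosure K m :=
  Subgroup.subset_normalClosure ⟨x, rfl⟩

theorem lowerT_mem_Tclosure (m : ℕ) (x : 𝓞 K) : lowerT K (m * x) ∈ Tclosure K m := by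
  let w : Matrix.SpecialLinearGroup (Fin 2) (𝓞 K) :=
    ⟨!![0, -1; 1, 0], by simp [Matrix.det_fin_two_of]⟩
  have hw : (w : Matrix (Fin 2) (Fin 2) (𝓞 K)) = !![0, -1; 1, 0] := rfl
  have hconj : w * T K (m * -x) * w⁻¹ = lowerT K (m * x) := by
    rw [mul_inv_eq_iff_eq_mul]
    ext i j
    fin_cases i <;> fin_cases j <;>
      simp [hw, Matrix.mul_apply, Fin.sum_univ_two]
  rw [← hconj]
  exact Subgroup.normalClosure_normal.conj_mem _ (T_mem_Tclosure m _) w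

theorem red_apply_coe (π : Ideal (𝓞 K)) (A : Matrix.SpecialLinearGroup (Fin 2) (𝓞 K))
    (i j : Fin 2) : red K π A i j = Ideal.Quotient.mk π (A i j) := rfl

/-- A matrix over a commutative ring with unit upper left entry and determinant one is determined
by its other two entries. -/
theorem Matrix.SpecialLinearGroup.ext_of_isUnit {R : Type*} [CommRing R]
    {A B : Matrix.SpecialLinearGroup (Fin 2) R} (hu : IsUnit (A 0 0)) (h00 : A 0 0 = B 0 0)
    (h01 : A 0 1 = B 0 1) (h10 : A 1 0 = B 1 0) : A = B := by
  have hA := A.det_coe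
  have hB := B.det_coe
  rw [Matrix.det_fin_two] at hA hB
  have h11 : A 1 1 = B 1 1 := by
    apply hu.mul_left_cancel
    linear_combination hA - hB - B 1 1 * h00 + A 1 0 * h01 + B 0 1 * h10
  ext i j
  fin_cases i <;> fin_cases j <;> assumption

theorem exists_entries_of_mem_Gamma {m : ℕ} {A : Matrix.SpecialLinearGroup (Fin 2) (𝓞 K)}
    (hA : A ∈ Gamma K (Ideal.span {(m : 𝓞 K)})) :
    ∃ t b c : 𝓞 K, A 0 0 = 1 + m * t ∧ A 0 1 = m * b ∧ A 1 0 = m * c := by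
  have h (i j : Fin 2) : Ideal.Quotient.mk (Ideal.span {(m : 𝓞 K)}) (A i j) =
      (1 : Matrix.SpecialLinearGroup (Fin 2) (𝓞 K ⧸ Ideal.span {(m : 𝓞 K)})) i j := by
    rw [← red_apply_coe, show red K _ A = 1 from hA]
  have h00 : Ideal.Quotient.mk (Ideal.span {(m : 𝓞 K)}) (A 0 0) = 1 := h 0 0
  have h01 : Ideal.Quotient.mk (Ideal.span {(m : 𝓞 K)}) (A 0 1) = 0 := h 0 1
  have h10 : Ideal.Quotient.mk (Ideal.span {(m : 𝓞 K)}) (A 1 0) = 0 := h 1 0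
  rw [Ideal.Quotient.eq_zero_iff_mem, Ideal.mem_span_singleton] at h01 h10
  rw [← map_one (Ideal.Quotient.mk _), Ideal.Quotient.eq, Ideal.mem_span_singleton] at h00
  obtain ⟨t, ht⟩ := h00
  obtain ⟨b, hb⟩ := h01
  obtain ⟨c, hc⟩ := h10
  exact ⟨t, b, c, by rw [← ht]; ring, hb, hc⟩

theorem mem_of_isUnit_of_entry_eq {H : Subgroup (Matrix.SpecialLinearGroup (Fin 2) (𝓞 K))} {m : ℕ}
    {π : Ideal (𝓞 K)} (hT : Tclosure K m ≤ H) (hπ : Gamma K π ≤ H)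
    {A B : Matrix.SpecialLinearGroup (Fin 2) (𝓞 K)} (hB : B ∈ H)
    (hu : IsUnit (Ideal.Quotient.mk π (A 0 0))) (h00 : A 0 0 = B 0 0) {b c b' c' : 𝓞 K}
    (hb : A 0 1 = m * b) (hc : A 1 0 = m * c) (hb' : B 0 1 = m * b') (hc' : B 1 0 = m * c') :
    A ∈ H := by
  obtain ⟨w', hw'⟩ := hu.exists_right_inv
  obtain ⟨w, rfl⟩ := Ideal.Quotient.mk_surjective w'
  set L := lowerT K (m * (w * (c' - c)))
  set U := T K (m * (w * (b' - b)))
  have e00 : (L * A * U) 0 0 = A 0 0 := by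
    simp [L, U, Matrix.vecMul, dotProduct, Matrix.mul_apply, Fin.sum_univ_two]
  have e01 : (L * A * U) 0 1 = A 0 0 * (m * (w * (b' - b))) + A 0 1 := by
    simp [L, U, Matrix.vecMul, dotProduct, Matrix.mul_apply, Fin.sum_univ_two]
  have e10 : (L * A * U) 1 0 = m * (w * (c' - c)) * A 0 0 + A 1 0 := by
    simp [L, U, Matrix.vecMul, dotProduct, Matrix.mul_apply, Fin.sum_univ_two]
  have hred : red K π (L * A * U) = red K π B := by
    apply Matrix.SpecialLinearGroup.ext_of_isUnit
    · rwa [red_apply_coe, e00]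
    · rw [red_apply_coe, red_apply_coe, e00, h00]
    · rw [red_apply_coe, red_apply_coe, e01, hb, hb']
      simp only [map_add, map_mul, map_sub]
      linear_combination (Ideal.Quotient.mk π m) *
        (Ideal.Quotient.mk π b' - Ideal.Quotient.mk π b) * hw'
    · rw [red_apply_coe, red_apply_coe, e10, hc, hc']
      simp only [map_add, map_mul, map_sub]
      linear_combination (Ideal.Quotient.mk π m) *
        (Ideal.Quotient.mk π c' - Ideal.Quotient.mk π c) * hw'
  have hmem : L * A * U * B⁻¹ ∈ H := hπ <| by
    change red K π _ = 1
    rw [map_mul, hred, ← map_mul, mul_inv_cancel, map_one]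
  have hL : L ∈ H := hT (lowerT_mem_Tclosure m _)
  have hU : U ∈ H := hT (T_mem_Tclosure m _)
  rwa [H.mul_mem_cancel_right (H.inv_mem hB), H.mul_mem_cancel_right hU,
    H.mul_mem_cancel_left hL] at hmem

theorem Gamma_span_le_of_Tclosure_le {H : Subgroup (Matrix.SpecialLinearGroup (Fin 2) (𝓞 K))}
    {m : ℕ} {π : Ideal (𝓞 K)} (hne : π ≠ ⊥) (hT : Tclosure K m ≤ H) (hπ : Gamma K π ≤ H) :
    Gamma K (Ideal.span {(m : 𝓞 K)}) ≤ H := by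
  intro A hA
  have : Finite (𝓞 K ⧸ π) := Ideal.finiteQuotientOfFreeOfNeBot π hne
  obtain ⟨t, b, c, ha, hb, hc⟩ := exists_entries_of_mem_Gamma hA
  have hcop : IsCoprime (A 0 0) (m * A 0 1) := by
    refine IsCoprime.mul_right ⟨1, -t, by rw [ha]; ring⟩ ⟨A 1 1, -A 1 0, ?_⟩
    have hdet := A.det_coe
    rw [Matrix.det_fin_two] at hdet
    linear_combination hdet
  obtain ⟨x', hx⟩ := (hcop.map (Ideal.Quotient.mk π)).exists_isUnit_add_mul
  obtain ⟨x, rfl⟩ := Ideal.Quotient.mk_surjective x'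
  rw [← map_mul, ← map_add] at hx
  have hL : lowerT K (m * x) ∈ H := hT (lowerT_mem_Tclosure m x)
  rw [← H.mul_mem_cancel_right hL]
  have e00 : (A * lowerT K (m * x)) 0 0 = A 0 0 + m * A 0 1 * x := by
    simp [Matrix.mul_apply, Fin.sum_univ_two]
    ring
  have e01 : (A * lowerT K (m * x)) 0 1 = m * b := by
    simp [Matrix.mul_apply, Fin.sum_univ_two, hb]
  have e10 : (A * lowerT K (m * x)) 1 0 = m * (c + A 1 1 * x) := by
    simp [Matrix.mul_apply, Fin.sum_univ_two, hc]
    ring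
  set s := t + A 0 1 * x with hs
  set B := lowerT K 1 * T K (m * -s) * (lowerT K 1)⁻¹
  have hB : B ∈ H :=
    hT (Subgroup.normalClosure_normal.conj_mem _ (T_mem_Tclosure m _) _)
  have f00 : B 0 0 = 1 + m * s := by
    simp [B, Matrix.mul_apply, Fin.sum_univ_two, Matrix.SpecialLinearGroup.coe_inv,
      Matrix.adjugate_fin_two]
  have f01 : B 0 1 = m * -s := by
    simp [B, Matrix.mul_apply, Fin.sum_univ_two, Matrix.SpecialLinearGroup.coe_inv,
      Matrix.adjugate_fin_two]
  have f10 : B 1 0 = m * s := by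
    simp [B, Matrix.mul_apply, Fin.sum_univ_two, Matrix.SpecialLinearGroup.coe_inv,
      Matrix.adjugate_fin_two]
  refine mem_of_isUnit_of_entry_eq hT hπ hB (by rwa [e00]) ?_ e01 e10 f01 f10
  rw [e00, f00, ha, hs]
  ring

variable (K)

/-- **Theorem 3.4 (Wohlfahrt's theorem for `SL(2,𝓞)`).** Let `H` be a finite-index subgroup
of `Γ = SL(2,𝓞)` of level `m`.  Then `H` is a congruence subgroup iff `Γ(m𝓞) ⊆ H`. -/
theorem wohlfahrt_Gamma (H : Subgroup (Matrix.SpecialLinearGroup (Fin 2) (𝓞 K)))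
    (hfin : H.FiniteIndex) (m : ℕ) (hlevel : HasLevel K H m) :
    IsCongruenceGamma K H ↔ Gamma K (Ideal.span {(m : 𝓞 K)}) ≤ H := by
  refine ⟨fun ⟨π, hne, hπ⟩ ↦ Gamma_span_le_of_Tclosure_le hne hlevel.2.1 hπ, fun h ↦ ⟨_, ?_, h⟩⟩
  rw [Ne, Ideal.span_singleton_eq_bot]
  exact_mod_cast hlevel.1.ne'
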